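/- Let c be a command. For any given dynamic policy D, channel a and initial store σ, c is PI secure against all forgetful attackers if and only if c is two-run PI secure for D on a for σ. -/

import Mathlib

/-- Program variables. -/
abbrev PVar := String
/-- Channels. -/
abbrev Chan := String
/-- Program points. -/
abbrev PPoint := String
/-- Values. -/
abbrev Val := ℤ
/-- Stores map program variables to values. -/
abbrev Store := PVar → Val

/-- Expressions: integer constants or variables. -/
inductive Expr where
  | const : Val → Expr
  | var : PVar → Expr
deriving DecidableEq

def Expr.eval : Expr → Store → Val
  | .const v, _ => v
  | .var x, σ => σ x

def Expr.fv : Expr → Set PVar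
  | .const _ => ∅
  | .var x => {x}

/-- Commands of the while-language with annotated outputs. -/
inductive Cmd where
  | skip : Cmd
  | seq : Cmd → Cmd → Cmd
  | assign : PVar → Expr → Cmd
  | ite : Expr → Cmd → Cmd → Cmd
  | while : Expr → Cmd → Cmd
  | out : Expr → Chan → PPoint → Cmd
deriving DecidableEq

/-- Step labels: silent, or an output (channel, value, program point). -/
inductive Label where
  | silent : Label
  | out : Chan → Val → PPoint → Label
deriving DecidableEq

abbrev Config := Cmd × Store

/-- Small-step semantics. -/
inductive Step : Config → Label → Config → Prop where
  | skipSeq : ∀ (c : Cmd) (σ : Store), Step (.seq .skip c, σ) .silent (c, σ)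
  | seq : ∀ {c₁ : Cmd} {σ : Store} {α : Label} {c₁' : Cmd} {σ' : Store} (c₂ : Cmd),
      Step (c₁, σ) α (c₁', σ') → Step (.seq c₁ c₂, σ) α (.seq c₁' c₂, σ')
  | assign : ∀ (x : PVar) (e : Expr) (σ : Store),
      Step (.assign x e, σ) .silent (.skip, Function.update σ x (e.eval σ))
  | out : ∀ (e : Expr) (a : Chan) (p : PPoint) (σ : Store),
      Step (.out e a p, σ) (.out a (e.eval σ) p) (.skip, σ)
  | whileStep : ∀ (e : Expr) (c : Cmd) (σ : Store),
      Step (.while e c, σ) .silent (.ite e (.seq c (.while e c)) .skip, σ)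
  | iteTrue : ∀ {e : Expr} {σ : Store} (c₁ c₂ : Cmd),
      e.eval σ ≠ 0 → Step (.ite e c₁ c₂, σ) .silent (c₁, σ)
  | iteFalse : ∀ {e : Expr} {σ : Store} (c₁ c₂ : Cmd),
      e.eval σ = 0 → Step (.ite e c₁ c₂, σ) .silent (c₂, σ)

/-- Prepend a label to a list of (output) labels, dropping silent labels. -/
def Label.consTo : Label → List Label → List Label
  | .silent, ls => ls
  | l, ls => l :: ls

/-- `Steps cfg ls n cfg'`: `n` evaluation steps from `cfg` to `cfg'`, producing
the list `ls` of output labels (silent steps contribute nothing). -/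
inductive Steps : Config → List Label → ℕ → Config → Prop where
  | refl : ∀ cfg, Steps cfg [] 0 cfg
  | step : ∀ {cfg : Config} {α : Label} {cfg' : Config} {ls : List Label} {n : ℕ} {cfg'' : Config},
      Step cfg α cfg' → Steps cfg' ls n cfg'' → Steps cfg (α.consTo ls) (n+1) cfg''

/-- Projection of a label list to the values output on channel `a`. -/
def projA (a : Chan) (ls : List Label) : List Val :=
  ls.filterMap fun l => match l with
    | .silent => none
    | .out b v _ => if b = a then some v else none

/-- `⟨c,σ⟩ ⇒t_a,n ⟨c',σ'⟩`: n steps producing trace `t` of values on channel `a`. -/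
def ProjSteps (cfg : Config) (a : Chan) (t : List Val) (n : ℕ) (cfg' : Config) : Prop :=
  ∃ ls, Steps cfg ls n cfg' ∧ projA a ls = t

/-- `⟨c,σ⟩ ⇒t_a`: the run of `c` from `σ` produces trace `t` on channel `a`. -/
def Produces (c : Cmd) (σ : Store) (a : Chan) (t : List Val) : Prop :=
  ∃ n cfg', ProjSteps (c, σ) a t n cfg'

/-- A forgetful attacker: a deterministic automaton over values. -/
structure Attacker (S : Type) where
  init : S
  step : S → Val → S

/-- The attacker's state after observing trace `t`. -/
def Attacker.run {S : Type} (A : Attacker S) (t : List Val) : S :=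
  t.foldl A.step A.init

/-- The counting variant `A^ω` of an attacker. -/
def Attacker.omega {S : Type} (A : Attacker S) : Attacker (S × ℕ) where
  init := (A.init, 0)
  step := fun sn v => (A.step sn.1 v, sn.2 + 1)

/-- Attacker knowledge `k(A,c,a,t)`. -/
def know {S : Type} (A : Attacker S) (c : Cmd) (a : Chan) (t : List Val) : Set Store :=
  { ρ | ∃ t', Produces c ρ a t' ∧ A.run t' = A.run t }

/-- Exclusion knowledge `ek(A,c,a,t)`. -/
def ek {S : Type} (A : Attacker S) (c : Cmd) (a : Chan) (t : List Val) : Set Store :=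
  (know A c a t)ᶜ

/-- Full progress knowledge `k#(A,c,a,t)`. -/
def kSharp {S : Type} (A : Attacker S) (c : Cmd) (a : Chan) (t : List Val) : Set Store :=
  { ρ | ∃ t' v, Produces c ρ a (t' ++ [v]) ∧ A.omega.run t' = A.omega.run t }

/-- Exclusion version `ek#(A,c,a,t)`. -/
def ekSharp {S : Type} (A : Attacker S) (c : Cmd) (a : Chan) (t : List Val) : Set Store :=
  (kSharp A c a t)ᶜ

/-- AC progress knowledge `k⁺(A,c,a,t)`. -/
def kPlus {S : Type} (A : Attacker S) (c : Cmd) (a : Chan) (t : List Val) : Set Store :=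
  { ρ | ∃ t' v, Produces c ρ a (t' ++ [v]) ∧ A.run t' = A.run t }

/-- Exclusion version `ek⁺(A,c,a,t)`. -/
def ekPlus {S : Type} (A : Attacker S) (c : Cmd) (a : Chan) (t : List Val) : Set Store :=
  (kPlus A c a t)ᶜ

/-- A dynamic policy: an equivalence relation on stores per channel and execution point. -/
structure DynPolicy where
  rel : Chan → Cmd → Store → ℕ → Store → Store → Prop
  isEquiv : ∀ a c σ n, Equivalence (rel a c σ n)

/-- Progress-insensitive security of `c` for policy `D` against attacker `A`
on channel `a` for initial store `σ`. -/
def PISecure {S : Type} (c : Cmd) (D : DynPolicy) (A : Attacker S) (a : Chan) (σ : Store) : Prop :=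
  ∀ t n c' σ' v, ProjSteps (c, σ) a t n (c', σ') →
    (∃ cfg', ProjSteps (c', σ') a [v] 1 cfg') →
    ek A c a (t ++ [v]) \ ekSharp A c a t ⊆ { ρ | ¬ D.rel a c σ n ρ σ }

/-- AC progress-insensitive security of `c` for policy `D` against attacker `A`
on channel `a` for initial store `σ`. -/
def ACPISecure {S : Type} (c : Cmd) (D : DynPolicy) (A : Attacker S) (a : Chan) (σ : Store) : Prop :=
  ∀ t n c' σ' v, ProjSteps (c, σ) a t n (c', σ') →
    (∃ cfg', ProjSteps (c', σ') a [v] 1 cfg') →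
    ek A c a (t ++ [v]) \ ekPlus A c a t ⊆ { ρ | ¬ D.rel a c σ n ρ σ }

/-- Two-run progress-insensitive security. -/
def TwoRunPISecure (c : Cmd) (D : DynPolicy) (a : Chan) (σ : Store) : Prop :=
  ∀ t n cn σn v, ProjSteps (c, σ) a t n (cn, σn) →
    (∃ cfg', ProjSteps (cn, σn) a [v] 1 cfg') →
    ∀ ρ t' v', D.rel a c σ n ρ σ → Produces c ρ a (t' ++ [v']) → t'.length = t.length →
      v' = v

/-- A counting attacker always remembers at least how many outputs it has seen. -/
def Attacker.Counting {S : Type} (A : Attacker S) : Prop :=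
  ∀ t t' : List Val, A.run t = A.run t' → t.length = t'.length

/-- A command is quasi-constant if, per channel, all its traces are prefixes of
one fixed (possibly infinite) trace. -/
def QuasiConstant (c : Cmd) : Prop :=
  ∀ a : Chan, ∃ u : ℕ → Val, ∀ σ t, Produces c σ a t →
    ∀ i : Fin t.length, t.get i = u i.val

/-- The variables of the dependency type system. -/
inductive TVar where
  | pvar : PVar → TVar
  | cpoint : Chan → PPoint → TVar
  | pc : TVar
  | chan : Chan → TVar
deriving DecidableEq

/-- Type environments. -/
abbrev Env := TVar → Set TVar

/-- The identity environment. -/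
def idEnv : Env := fun x => {x}

/-- Sequential composition of environments: `(Γ₂;Γ₁)(x) = ⋃_{y ∈ Γ₂(x)} Γ₁(y)`. -/
def envComp (Γ₂ Γ₁ : Env) : Env := fun x => ⋃ y ∈ Γ₂ x, Γ₁ y

/-- Pointwise union of environments. -/
def envUnion (Γ₁ Γ₂ : Env) : Env := fun x => Γ₁ x ∪ Γ₂ x

/-- Iterates of an environment. -/
def envIter (Γ : Env) : ℕ → Env
  | 0 => idEnv
  | n+1 => envComp (envIter Γ n) Γ

/-- The fixed point `Γ* = ⋃_{n≥0} Γⁿ`. -/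
def envStar (Γ : Env) : Env := fun x => ⋃ n, envIter Γ n x

/-- Free variables of an expression, as type-system variables. -/
def fvT (e : Expr) : Set TVar := TVar.pvar '' e.fv

/-- The dependency type system `⊢{c}Γ`. -/
inductive Typing : Cmd → Env → Prop where
  | skip : Typing .skip idEnv
  | assign : ∀ (x : PVar) (e : Expr),
      Typing (.assign x e) (Function.update idEnv (.pvar x) (fvT e ∪ {TVar.pc}))
  | seq : ∀ {c₁ : Cmd} {Γ₁ : Env} {c₂ : Cmd} {Γ₂ : Env},
      Typing c₁ Γ₁ → Typing c₂ Γ₂ → Typing (.seq c₁ c₂) (envComp Γ₂ Γ₁)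
  | ite : ∀ {e : Expr} {c₁ : Cmd} {Γ₁ : Env} {c₂ : Cmd} {Γ₂ : Env},
      Typing c₁ Γ₁ → Typing c₂ Γ₂ →
      Typing (.ite e c₁ c₂)
        (Function.update
          (envUnion (envComp Γ₁ (Function.update idEnv .pc ({TVar.pc} ∪ fvT e)))
                    (envComp Γ₂ (Function.update idEnv .pc ({TVar.pc} ∪ fvT e))))
          .pc {TVar.pc})
  | whileT : ∀ {e : Expr} {c : Cmd} {Γc : Env}, Typing c Γc →
      Typing (.while e c)
        (Function.update
          (envStar (envComp Γc (Function.update idEnv .pc ({TVar.pc} ∪ fvT e))))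
          .pc {TVar.pc})
  | out : ∀ (e : Expr) (a : Chan) (p : PPoint),
      Typing (.out e a p)
        (Function.update
          (Function.update idEnv (.cpoint a p)
            (fvT e ∪ {TVar.pc, TVar.chan a, TVar.cpoint a p}))
          (.chan a) {TVar.pc, TVar.chan a})

/-- `σ ≡_{Γ(x)} ρ`: the stores agree on all program variables in `Γ(x)`. -/
def eqG (Γ : Env) (x : TVar) (σ ρ : Store) : Prop :=
  ∀ y : PVar, TVar.pvar y ∈ Γ x → σ y = ρ y

/-- A dynamic policy approximation: an equivalence relation on stores per
channel–program-point pair. -/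
structure PolApprox where
  rel : Chan → PPoint → Store → Store → Prop
  isEquiv : ∀ a p, Equivalence (rel a p)

/-- `c : A` is a sound approximation of dynamic policy `D`. -/
def SoundApprox (c : Cmd) (A : PolApprox) (D : DynPolicy) : Prop :=
  ∀ σ n ls c' σ' a v p cfg'',
    Steps (c, σ) ls n (c', σ') → Step (c', σ') (.out a v p) cfg'' →
    ∀ ρ₁ ρ₂, D.rel a c σ n ρ₁ ρ₂ → A.rel a p ρ₁ ρ₂

theorem Step.det {x α y} (h : Step x α y) : ∀ {β z}, Step x β z → α = β ∧ y = z := by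
  induction h with
  | skipSeq c σ =>
    intro β z h2
    cases h2 with
    | skipSeq => exact ⟨rfl, rfl⟩
    | seq _ h => cases h
  | seq c₂ h ih =>
    intro β z h2
    cases h2 with
    | skipSeq => cases h
    | seq _ h' =>
      obtain ⟨h1, h2⟩ := ih h'
      cases h1
      cases h2
      exact ⟨rfl, rfl⟩
  | assign => intro β z h2; cases h2; exact ⟨rfl, rfl⟩
  | out => intro β z h2; cases h2; exact ⟨rfl, rfl⟩
  | whileStep => intro β z h2; cases h2; exact ⟨rfl, rfl⟩
  | iteTrue c₁ c₂ h =>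
    intro β z h2
    cases h2 with
    | iteTrue => exact ⟨rfl, rfl⟩
    | iteFalse _ _ h' => exact absurd h' h
  | iteFalse c₁ c₂ h =>
    intro β z h2
    cases h2 with
    | iteTrue _ _ h' => exact absurd h h'
    | iteFalse => exact ⟨rfl, rfl⟩

theorem consTo_eq_append (α : Label) : ∃ p, ∀ ls, α.consTo ls = p ++ ls := by
  cases α with
  | silent => exact ⟨[], fun _ => rfl⟩
  | out b v p => exact ⟨[.out b v p], fun _ => rfl⟩

theorem Steps.comparable {x ls n y} (h : Steps x ls n y) :
    ∀ {ls' m z}, Steps x ls' m z → ls <+: ls' ∨ ls' <+: ls := by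
  induction h with
  | refl => intros; exact Or.inl ⟨_, rfl⟩
  | step h hs ih =>
    intro ls' m z h2
    cases h2 with
    | refl => exact Or.inr ⟨_, rfl⟩
    | step h' hs' =>
      obtain ⟨h1, h2⟩ := h.det h'
      subst h1
      subst h2
      obtain ⟨p, hp⟩ := consTo_eq_append ‹Label›
      rw [hp, hp, List.prefix_append_right_inj, List.prefix_append_right_inj]
      exact ih hs'

theorem Produces.eq_of_length {c : Cmd} {ρ : Store} {a : Chan} {t t' : List Val}
    (h : Produces c ρ a t) (h' : Produces c ρ a t') (hl : t.length = t'.length) : t = t' := by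
  obtain ⟨n, x, ls, hs, rfl⟩ := h
  obtain ⟨m, y, ls', hs', rfl⟩ := h'
  rcases hs.comparable hs' with hp | hp
  · exact (hp.filterMap _).eq_of_length hl
  · exact ((hp.filterMap _).eq_of_length hl.symm).symm

theorem Attacker.run_snoc {S : Type} (A : Attacker S) (t : List Val) (v : Val) :
    A.run (t ++ [v]) = A.step (A.run t) v := by
  simp [Attacker.run]

theorem Attacker.omega_run {S : Type} (A : Attacker S) (t : List Val) :
    A.omega.run t = (A.run t, t.length) := by
  induction t using List.reverseRecOn with
  | nil => rfl
  | append_singleton t v ih =>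
    rw [Attacker.run_snoc, Attacker.run_snoc, ih]
    simp [Attacker.omega]

/-- The attacker that counts, and remembers only the output at position `k`. -/
def posAttacker (k : ℕ) : Attacker (ℕ × Option Val) where
  init := (0, none)
  step := fun s v => (s.1 + 1, if s.1 = k then some v else s.2)

theorem posAttacker_run (k : ℕ) (t : List Val) :
    (posAttacker k).run t = (t.length, t[k]?) := by
  induction t using List.reverseRecOn with
  | nil => rfl
  | append_singleton t v ih =>
    rw [Attacker.run_snoc, ih]
    simp only [posAttacker, List.length_append, List.length_singleton, Prod.mk.injEq, true_and]
    grind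

/-- PI security against all attackers iff two-run PI security. -/
theorem PISecure_all_iff_twoRun (c : Cmd) (D : DynPolicy) (a : Chan) (σ : Store) :
    (∀ (S : Type) (A : Attacker S), PISecure c D A a σ) ↔ TwoRunPISecure c D a σ := by
  constructor
  · intro H t n cn σn v h1 h2 ρ t' v' hrel hprod hlen
    have hk : ρ ∈ know (posAttacker t.length) c a (t ++ [v]) := by
      by_contra hn
      refine H _ (posAttacker t.length) t n cn σn v h1 h2 ⟨hn, ?_⟩ hrel
      intro hns
      refine hns ⟨t', v', hprod, ?_⟩
      rw [Attacker.omega_run, Attacker.omega_run, posAttacker_run, posAttacker_run]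
      have e1 : t'[t.length]? = none := List.getElem?_eq_none hlen.le
      have e2 : t[t.length]? = none := List.getElem?_eq_none le_rfl
      rw [e1, e2, hlen]
    obtain ⟨u, hu, he⟩ := hk
    rw [posAttacker_run, posAttacker_run] at he
    simp only [Prod.mk.injEq] at he
    have hut : u = t' ++ [v'] := hu.eq_of_length hprod (by simp [he.1, hlen])
    have h3 := he.2
    rw [hut] at h3
    simpa [← hlen] using h3
  · intro H S A t n c' σ' v h1 h2 ρ hρ hrel
    obtain ⟨hn, hk⟩ := hρ
    apply hk
    rintro ⟨t', v', hprod, he⟩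
    rw [Attacker.omega_run, Attacker.omega_run] at he
    simp only [Prod.mk.injEq] at he
    have hv := H t n c' σ' v h1 h2 ρ t' v' hrel hprod he.2
    subst hv
    exact hn ⟨t' ++ [v'], hprod, by rw [Attacker.run_snoc, Attacker.run_snoc, he.1]⟩
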